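/- For every λ ∈ 𝒮_n(q), the supercharacter degree is χ^λ(1) = ∏ q^{j−i−1}, the product being over all pairs (i,j) with i < j and λ_{ij} ≠ 0. -/

import Mathlib

open Matrix BigOperators
open scoped Classical

/-- `n × n` matrices over `F`. -/
abbrev Mat (n : ℕ) (F : Type*) := Matrix (Fin n) (Fin n) F

section Defs

variable {n : ℕ} {F : Type*} [Field F] [Fintype F]

/-- The pattern group `U_P` attached to a relation `P` on `{0,…,n-1}`:
unipotent upper-triangular matrices supported (off the diagonal) on positions `(i,j)` with `P i j`. -/
def patGroup (P : Fin n → Fin n → Prop) : Set (Mat n F) :=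
  {u | (∀ i, u i i = 1) ∧ ∀ i j, i ≠ j → ¬ P i j → u i j = 0}

/-- Truncation of a matrix to the positions allowed by `P` (used to identify a functional on
`𝔫_P` with the matrix of its coefficients on allowable positions). -/
noncomputable def truncP (P : Fin n → Fin n → Prop) (A : Mat n F) : Mat n F :=
  Matrix.of fun i j => if P i j then A i j else 0

/-- The left orbit `U_P λ` of the functional (identified with a matrix) `lam`:
`(aλ)(x) = λ(a⁻¹ x)`, whose coefficient matrix is the truncation of `(a⁻¹)ᵀ * λ`. -/
noncomputable def dualLeftOrbit (P : Fin n → Fin n → Prop) (lam : Mat n F) : Set (Mat n F) :=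
  {mu | ∃ a ∈ (patGroup P : Set (Mat n F)), mu = truncP P ((a⁻¹)ᵀ * lam)}

/-- The two-sided orbit `U_P λ U_P` of the functional `lam`: `(aλb)(x) = λ(a⁻¹ x b⁻¹)`,
whose coefficient matrix is the truncation of `(a⁻¹)ᵀ * λ * (b⁻¹)ᵀ`. -/
noncomputable def dualOrbit (P : Fin n → Fin n → Prop) (lam : Mat n F) : Set (Mat n F) :=
  {mu | ∃ a ∈ (patGroup P : Set (Mat n F)), ∃ b ∈ (patGroup P : Set (Mat n F)),
    mu = truncP P ((a⁻¹)ᵀ * lam * (b⁻¹)ᵀ)}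

/-- The two-sided superclass orbit `{a (v-1) b : a, b ∈ U_P}` attached to `v ∈ U_P`. -/
def classOrbit (P : Fin n → Fin n → Prop) (v : Mat n F) : Set (Mat n F) :=
  {x | ∃ a ∈ (patGroup P : Set (Mat n F)), ∃ b ∈ (patGroup P : Set (Mat n F)),
    x = a * (v - 1) * b}

/-- The pairing `λ(x) = Σ_{i,j} λ_{ij} x_{ij}` of a functional-matrix with a matrix. -/
def pairM (A B : Mat n F) : F := ∑ i, ∑ j, A i j * B i j

/-- The supercharacter `χ^λ` of the pattern group `U_P` attached to the functional `lam`: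
`χ^λ(u) = (|U_Pλ|/|U_PλU_P|) Σ_{μ ∈ U_PλU_P} θ(−μ(u−1))`. -/
noncomputable def superChar (P : Fin n → Fin n → Prop) (θ : AddChar F ℂ)
    (lam u : Mat n F) : ℂ :=
  ((dualLeftOrbit P lam).ncard : ℂ) / ((dualOrbit P lam).ncard : ℂ) *
    ∑ᶠ mu ∈ dualOrbit P lam, θ (- pairM mu (u - 1))

/-- The full order `i < j`, whose pattern group is `U_n`. -/
def Plt (n : ℕ) : Fin n → Fin n → Prop := fun i j => i < j

/-- The poset `𝒫_(m)` (in 0-based indexing): `i < j`, except that row `0` (row `1` in 1-based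
indexing) is only comparable to columns `j` with 1-based value `j+1 > m`.  Its pattern group is
the interpolating group `U_(m)`. -/
def Pm (n m : ℕ) : Fin n → Fin n → Prop := fun i j => i < j ∧ (i.val = 0 → m < j.val + 1)

/-- `𝒮_n(q)`: strictly upper-triangular matrices with at most one nonzero entry in each row
and each column. -/
def Sset (n : ℕ) (F : Type*) [Field F] : Set (Mat n F) :=
  {lam | (∀ i j : Fin n, ¬ i < j → lam i j = 0) ∧
    (∀ (i j j' : Fin n), lam i j ≠ 0 → lam i j' ≠ 0 → j = j') ∧
    (∀ (i i' j : Fin n), lam i j ≠ 0 → lam i' j ≠ 0 → i = i')}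

/-- Adjacency of two nonzero positions of `A` (they share a row or a column): the edges of
the graph `G_A`. -/
def adjRel (A : Mat n F) (p q : Fin n × Fin n) : Prop :=
  p ≠ q ∧ A p.1 p.2 ≠ 0 ∧ A q.1 q.2 ≠ 0 ∧ (p.1 = q.1 ∨ p.2 = q.2)

/-- The connected component of the position `p` in the graph `G_A`. -/
def compOf (A : Mat n F) (p : Fin n × Fin n) : Set (Fin n × Fin n) :=
  {q | Relation.ReflTransGen (adjRel A) p q}

/-- The set of connected components of the graph `G_A`. -/
def comps (A : Mat n F) : Set (Set (Fin n × Fin n)) :=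
  {S | ∃ p : Fin n × Fin n, A p.1 p.2 ≠ 0 ∧ S = compOf A p}

/-- The matrix agreeing with `A` on the positions of `S` and vanishing elsewhere. -/
noncomputable def restrictTo (S : Set (Fin n × Fin n)) (A : Mat n F) : Mat n F :=
  Matrix.of fun i j => if (i, j) ∈ S then A i j else 0

/-- At most one connected component of `G_A` has more than one vertex. -/
def AtMostOneBig (A : Mat n F) : Prop :=
  ∀ p q : Fin n × Fin n, A p.1 p.2 ≠ 0 → A q.1 q.2 ≠ 0 →
    1 < (compOf A p).ncard → 1 < (compOf A q).ncard → compOf A p = compOf A q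

end Defs

section PatternGroup

variable {n : ℕ} {F : Type*} [Field F]

theorem one_mem_patGroup (P : Fin n → Fin n → Prop) : (1 : Mat n F) ∈ patGroup P :=
  ⟨fun _ => Matrix.one_apply_eq _, fun _ _ h _ => Matrix.one_apply_ne h⟩

theorem blockTriangular_of_mem_patGroup {a : Mat n F} (ha : a ∈ patGroup (Plt n)) :
    a.BlockTriangular id :=
  fun _ _ hij => ha.2 _ _ (ne_of_gt hij) (lt_asymm hij)

theorem isUnit_det_of_mem_patGroup {a : Mat n F} (ha : a ∈ patGroup (Plt n)) :
    IsUnit a.det := by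
  rw [Matrix.det_of_isUpperTriangular (blockTriangular_of_mem_patGroup ha),
    Finset.prod_eq_one fun i _ => ha.1 i]
  exact isUnit_one

theorem inv_mem_patGroup {a : Mat n F} (ha : a ∈ patGroup (Plt n)) :
    a⁻¹ ∈ patGroup (Plt n) := by
  have hdet := isUnit_det_of_mem_patGroup ha
  have : Invertible a := a.invertibleOfIsUnitDet hdet
  have htri : a⁻¹.BlockTriangular id :=
    Matrix.blockTriangular_inv_of_blockTriangular (blockTriangular_of_mem_patGroup ha)
  refine ⟨fun i => ?_, fun i j hij hlt => htri (lt_of_le_of_ne (not_lt.1 hlt) hij.symm)⟩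
  have h := congrFun (congrFun (a.mul_nonsing_inv hdet) i) i
  rw [Matrix.mul_apply, Matrix.one_apply_eq, Finset.sum_eq_single i, ha.1 i, one_mul] at h
  · exact h
  · intro k _ hki
    rcases lt_or_gt_of_ne hki with hk | hk
    · rw [blockTriangular_of_mem_patGroup ha hk, zero_mul]
    · rw [htri hk, mul_zero]
  · simp

/-- The left orbit of `λ ∈ 𝒮_n(q)` consists of the matrices that agree with `λ` except at the
positions strictly below a nonzero entry of `λ` and strictly above the diagonal. -/
theorem mem_dualLeftOrbit_iff {lam : Mat n F} (hlam : lam ∈ Sset n F) (mu : Mat n F) :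
    mu ∈ dualLeftOrbit (Plt n) lam ↔
      ∀ k j, (¬ ∃ i, lam i j ≠ 0 ∧ i < k ∧ k < j) → mu k j = lam k j := by
  obtain ⟨hup, hrow, hcol⟩ := hlam
  constructor
  · rintro ⟨a, ha, rfl⟩ k j hkj
    obtain ⟨hdiag, htri⟩ := inv_mem_patGroup ha
    simp only [truncP, Matrix.of_apply, Matrix.mul_apply, Matrix.transpose_apply]
    by_cases hlt : Plt n k j
    · rw [if_pos hlt, Finset.sum_eq_single k, hdiag, one_mul]
      · intro i _ hik
        by_cases hl : lam i j = 0
        · rw [hl, mul_zero]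
        · rw [htri i k hik fun h => hkj ⟨i, hl, h, hlt⟩, zero_mul]
      · simp
    · rw [if_neg hlt, hup k j hlt]
  · intro hmu
    let b : Mat n F := Matrix.of fun i k =>
      if i = k then 1 else if i < k then ∑ j, if k < j then mu k j * (lam i j)⁻¹ else 0 else 0
    have hb : b ∈ patGroup (Plt n) :=
      ⟨fun i => by simp [b], fun i j hij hlt => by
        simp only [Plt] at hlt
        simp [b, hij, hlt]⟩
    refine ⟨b⁻¹, inv_mem_patGroup hb, ?_⟩
    rw [Matrix.nonsing_inv_nonsing_inv _ (isUnit_det_of_mem_patGroup hb)]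
    ext k j
    simp only [truncP, Matrix.of_apply, Matrix.mul_apply, Matrix.transpose_apply]
    by_cases hlt : Plt n k j
    · rw [if_pos hlt]
      by_cases hex : ∃ i, lam i j ≠ 0 ∧ i < k ∧ k < j
      · obtain ⟨i, hi, hik, -⟩ := hex
        rw [Finset.sum_eq_single i]
        · have hbik : b i k = mu k j * (lam i j)⁻¹ := by
            simp only [b, Matrix.of_apply, if_neg hik.ne, if_pos hik]
            rw [Finset.sum_eq_single j, if_pos (show k < j from hlt)]
            · intro j' _ hj'
              have : lam i j' = 0 := by
                by_contra h
                exact hj' (hrow i j' j h hi)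
              simp [this]
            · simp
          rw [hbik, inv_mul_cancel_right₀ hi]
        · intro i' _ hi'
          have : lam i' j = 0 := by
            by_contra h
            exact hi' (hcol i' i j h hi)
          rw [this, mul_zero]
        · simp
      · rw [hmu k j hex, Finset.sum_eq_single k, hb.1 k, one_mul]
        · intro i _ hik
          by_cases hl : lam i j = 0
          · rw [hl, mul_zero]
          · rw [hb.2 i k hik fun h => hex ⟨i, hl, h, hlt⟩, zero_mul]
        · simp
    · rw [if_neg hlt, hmu k j fun ⟨_, _, _, h⟩ => hlt h, hup k j hlt]

theorem ncard_dualLeftOrbit [Fintype F] {lam : Mat n F} (hlam : lam ∈ Sset n F) :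
    (dualLeftOrbit (Plt n) lam).ncard =
      ∏ p ∈ Finset.univ.filter (fun p : Fin n × Fin n => p.1 < p.2 ∧ lam p.1 p.2 ≠ 0),
        Fintype.card F ^ (p.2.val - p.1.val - 1) := by
  have horbit : dualLeftOrbit (Plt n) lam =
      Set.image Matrix.of ((Fintype.piFinset fun k => Fintype.piFinset fun j =>
        if ∃ i, lam i j ≠ 0 ∧ i < k ∧ k < j then Finset.univ else {lam k j} :
          Finset (Fin n → Fin n → F)) : Set (Fin n → Fin n → F)) := by
    ext mu
    rw [mem_dualLeftOrbit_iff hlam, Equiv.image_eq_preimage_symm, Set.mem_preimage]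
    simp only [Finset.mem_coe, Fintype.mem_piFinset, Matrix.of_symm_apply]
    refine forall₂_congr fun k j => ?_
    split_ifs with h <;> simp [h]
  rw [horbit, Set.ncard_image_of_injective _ Matrix.of.injective, Set.ncard_coe_finset, Fintype.card_piFinset]
  simp only [Fintype.card_piFinset]
  rw [Finset.prod_comm, Finset.prod_filter, Fintype.prod_prod_type_right]
  refine Finset.prod_congr rfl fun j _ => ?_
  by_cases hex : ∃ i, lam i j ≠ 0
  · obtain ⟨i, hi⟩ := hex
    have hij : i < j := by
      by_contra h
      exact hi (hlam.1 i j h)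
    have huniq : ∀ i', lam i' j ≠ 0 → i' = i := fun i' h => hlam.2.2 i' i j h hi
    rw [Finset.prod_eq_single i (fun i' _ hi' => if_neg fun h => hi' (huniq i' h.2)) (by simp),
      if_pos ⟨hij, hi⟩]
    have hiff : ∀ k, (∃ i', lam i' j ≠ 0 ∧ i' < k ∧ k < j) ↔ k ∈ Finset.Ioo i j := by
      intro k
      rw [Finset.mem_Ioo]
      exact ⟨fun ⟨i', h, h'⟩ => huniq i' h ▸ h', fun h => ⟨i, hi, h⟩⟩
    simp only [hiff, apply_ite Finset.card, Finset.card_univ, Finset.card_singleton]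
    rw [Finset.prod_ite_mem, Finset.univ_inter, Finset.prod_const, Fin.card_Ioo]
  · push Not at hex
    simp [hex]

theorem superChar_one [Fintype F] (P : Fin n → Fin n → Prop) (θ : AddChar F ℂ) (lam : Mat n F) :
    superChar P θ lam 1 = (dualLeftOrbit P lam).ncard := by
  have hne : (dualOrbit P lam).Nonempty :=
    ⟨_, 1, one_mem_patGroup P, 1, one_mem_patGroup P, rfl⟩
  have hcard : ((dualOrbit P lam).ncard : ℂ) ≠ 0 :=
    Nat.cast_ne_zero.2 ((Set.ncard_pos (Set.toFinite _)).2 hne).ne'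
  have hsum : ∑ᶠ mu ∈ dualOrbit P lam, θ (- pairM mu ((1 : Mat n F) - 1)) =
      ((dualOrbit P lam).ncard : ℂ) := by
    simp only [pairM, sub_self, Matrix.zero_apply, mul_zero, Finset.sum_const_zero, neg_zero,
      AddChar.map_zero_eq_one]
    rw [finsum_mem_eq_finite_toFinset_sum _ (Set.toFinite _), Finset.sum_const, nsmul_one,
      Set.ncard_eq_toFinset_card _ (Set.toFinite _)]
  rw [superChar, hsum, div_mul_cancel₀ _ hcard]

end PatternGroup

/-- For `λ ∈ 𝒮_n(q)` the supercharacter degree is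
`χ^λ(1) = ∏_{i<j, λ_{ij} ≠ 0} q^{j−i−1}`. -/
theorem stmt3 {n : ℕ} (hn : 1 ≤ n) {F : Type*} [Field F] [Fintype F]
    (θ : AddChar F ℂ) (hθ : ∃ x, θ x ≠ 1)
    (lam : Mat n F) (hlam : lam ∈ Sset n F) :
    superChar (Plt n) θ lam 1 =
      ∏ p ∈ Finset.univ.filter (fun p : Fin n × Fin n => p.1 < p.2 ∧ lam p.1 p.2 ≠ 0),
        (Fintype.card F : ℂ) ^ (p.2.val - p.1.val - 1) := by
  rw [superChar_one, ncard_dualLeftOrbit hlam]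
  push_cast
  rfl
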